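/- Let 0 < α < 1, let u : [a,b] → ℝ be continuous, let A be a knot collection of size k+1 on [a,b] with maximum knot size h = max_{0≤i≤k} (t_{i+1} − t_i), and let q ∈ ℕ, q ≥ 1. Then the spline fractional integration operator is bounded: sup_{t∈[a,b]} |(S^q_A (I_a^α u))(t)| ≤ (( (5/2)(h/√q)^α + (b−a)^α ) / Γ(α+1)) · ‖u‖_{C[a,b]}. -/

import Mathlib

/-- Riemann–Liouville fractional integral `(I_a^α f)(t)`. -/
noncomputable def rlInt (a α : ℝ) (f : ℝ → ℝ) (t : ℝ) : ℝ :=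
  (1 / Real.Gamma α) * ∫ s in a..t, (t - s) ^ (α - 1) * f s

/-- Bernstein operator of order `q` for `f` on the interval `[a, b]`. -/
noncomputable def bern (a b : ℝ) (q : ℕ) (f : ℝ → ℝ) (t : ℝ) : ℝ :=
  ∑ j ∈ Finset.range (q + 1),
    f (a + (j : ℝ) * (b - a) / (q : ℝ)) * (q.choose j : ℝ) *
      ((t - a) / (b - a)) ^ j * ((b - t) / (b - a)) ^ (q - j)

/-- The `i`-th knot interval of a knot collection of size `k+1` with knots `tk`:
half-open `[t_i, t_{i+1})` for `i < k`, closed `[t_k, t_{k+1}]` for `i = k`. -/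
def knotSet (tk : ℕ → ℝ) (k i : ℕ) : Set ℝ :=
  if i < k then Set.Ico (tk i) (tk (i + 1)) else Set.Icc (tk i) (tk (i + 1))

/-- Bernstein spline operator of order `q` on a knot collection of size `k+1`. -/
noncomputable def spline (tk : ℕ → ℝ) (k q : ℕ) (f : ℝ → ℝ) (t : ℝ) : ℝ :=
  ∑ i ∈ Finset.range (k + 1),
    (knotSet tk k i).indicator (bern (tk i) (tk (i + 1)) q f) t

/-- Sup norm `‖f‖_{C[a,b]} = sup_{t ∈ [a,b]} |f(t)|`. -/
noncomputable def supNorm (f : ℝ → ℝ) (a b : ℝ) : ℝ :=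
  sSup ((fun t => |f t|) '' Set.Icc a b)

lemma rl_bound (α a b M : ℝ) (hα0 : 0 < α) (u : ℝ → ℝ) (hM : ∀ s ∈ Set.Icc a b, |u s| ≤ M)
    (t : ℝ) (ht : t ∈ Set.Icc a b) :
    |rlInt a α u t| ≤ (b - a) ^ α / Real.Gamma (α + 1) * M := by
  have hM0 : 0 ≤ M := (abs_nonneg _).trans (hM t ht)
  have hG : 0 < Real.Gamma α := Real.Gamma_pos_of_pos hα0
  have hint : IntervalIntegrable (fun s => (t - s) ^ (α - 1) * M) MeasureTheory.volume a t := by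
    have h1 : IntervalIntegrable (fun x : ℝ => x ^ (α - 1)) MeasureTheory.volume (t - a) (t - t) :=
      intervalIntegral.intervalIntegrable_rpow' (by linarith)
    have h2 := h1.comp_sub_left t
    simp only [sub_sub_cancel] at h2
    exact h2.mul_const M
  have hI : |∫ s in a..t, (t - s) ^ (α - 1) * u s| ≤ ∫ s in a..t, (t - s) ^ (α - 1) * M := by
    rw [← Real.norm_eq_abs]
    refine intervalIntegral.norm_integral_le_of_norm_le ht.1 ?_ hint
    refine Filter.Eventually.of_forall fun s hs => ?_
    have h3 : 0 ≤ (t - s) ^ (α - 1) := Real.rpow_nonneg (by linarith [hs.2]) _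
    rw [Real.norm_eq_abs, abs_mul, abs_of_nonneg h3]
    exact mul_le_mul_of_nonneg_left (hM s ⟨hs.1.le, hs.2.trans ht.2⟩) h3
  have hE : ∫ s in a..t, (t - s) ^ (α - 1) * M = (t - a) ^ α / α * M := by
    rw [intervalIntegral.integral_mul_const,
      intervalIntegral.integral_comp_sub_left (fun x : ℝ => x ^ (α - 1)) t,
      integral_rpow (Or.inl (by linarith))]
    simp [Real.zero_rpow hα0.ne']
  have hle : (t - a) ^ α ≤ (b - a) ^ α :=
    Real.rpow_le_rpow (by linarith [ht.1]) (by linarith [ht.2]) hα0.le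
  rw [rlInt, abs_mul, abs_of_pos (by positivity), Real.Gamma_add_one hα0.ne']
  calc 1 / Real.Gamma α * |∫ s in a..t, (t - s) ^ (α - 1) * u s|
      ≤ 1 / Real.Gamma α * ((b - a) ^ α / α * M) := by
        rw [hE] at hI
        refine mul_le_mul_of_nonneg_left (hI.trans ?_) (by positivity)
        gcongr
    _ = _ := by field_simp

lemma bern_bound (a b K : ℝ) (hab : a < b) (q : ℕ) (hq : 1 ≤ q) (f : ℝ → ℝ)
    (hf : ∀ s ∈ Set.Icc a b, |f s| ≤ K) (t : ℝ) (ht : t ∈ Set.Icc a b) :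
    |bern a b q f t| ≤ K := by
  have hba : 0 < b - a := by linarith
  have hx : 0 ≤ (t - a) / (b - a) := div_nonneg (by linarith [ht.1]) hba.le
  have hy : 0 ≤ (b - t) / (b - a) := div_nonneg (by linarith [ht.2]) hba.le
  have hxy : (t - a) / (b - a) + (b - t) / (b - a) = 1 := by field_simp; ring
  have hb := add_pow ((t - a) / (b - a)) ((b - t) / (b - a)) q
  rw [hxy, one_pow] at hb
  unfold bern
  generalize (t - a) / (b - a) = x at *
  generalize (b - t) / (b - a) = y at *
  refine (Finset.abs_sum_le_sum_abs _ _).trans ?_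
  have : K = ∑ m ∈ Finset.range (q + 1), K * (x ^ m * y ^ (q - m) * (q.choose m : ℝ)) := by
    rw [← Finset.mul_sum, ← hb, mul_one]
  rw [this]
  refine Finset.sum_le_sum fun j hj => ?_
  have hjq : (j : ℝ) ≤ q := by
    exact_mod_cast Nat.lt_succ_iff.mp (Finset.mem_range.mp hj)
  have hq0 : (0 : ℝ) < q := by exact_mod_cast hq
  have hmem : a + (j : ℝ) * (b - a) / (q : ℝ) ∈ Set.Icc a b := by
    constructor
    · have : 0 ≤ (j : ℝ) * (b - a) / (q : ℝ) := by positivity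
      linarith
    · have : (j : ℝ) * (b - a) / (q : ℝ) ≤ b - a := by
        rw [div_le_iff₀ hq0]
        nlinarith
      linarith
  have hn : 0 ≤ x ^ j * y ^ (q - j) * (q.choose j : ℝ) := by positivity
  calc |f (a + (j : ℝ) * (b - a) / (q : ℝ)) * (q.choose j : ℝ) * x ^ j * y ^ (q - j)|
      = |f (a + (j : ℝ) * (b - a) / (q : ℝ))| * (x ^ j * y ^ (q - j) * (q.choose j : ℝ)) := by
        rw [← abs_of_nonneg hn, ← abs_mul]
        congr 1
        ring
    _ ≤ _ := mul_le_mul_of_nonneg_right (hf _ hmem) hn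

lemma knotSet_sub (tk : ℕ → ℝ) (k i : ℕ) : knotSet tk k i ⊆ Set.Icc (tk i) (tk (i + 1)) := by
  unfold knotSet
  split_ifs
  · exact Set.Ico_subset_Icc_self
  · exact le_rfl

lemma knot_mono (tk : ℕ → ℝ) (k : ℕ) (hmono : ∀ i ≤ k, tk i < tk (i + 1)) (i j : ℕ)
    (hij : i ≤ j) (hj : j ≤ k + 1) : tk i ≤ tk j := by
  induction j, hij using Nat.le_induction with
  | base => exact le_rfl
  | succ n hn ih => exact (ih (by omega)).trans (hmono n (by omega)).le

lemma knot_disj (tk : ℕ → ℝ) (k : ℕ) (hmono : ∀ i ≤ k, tk i < tk (i + 1)) (i j : ℕ)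
    (hij : i < j) (hj : j ≤ k) (t : ℝ) (hi : t ∈ knotSet tk k i) : t ∉ knotSet tk k j := by
  intro hj'
  have h1 := (knotSet_sub tk k j hj').1
  rw [knotSet, if_pos (by omega)] at hi
  have := knot_mono tk k hmono (i + 1) j hij (by omega)
  linarith [hi.2]

/-- Boundedness of the spline fractional integration operator. -/
theorem stmt5 (α a b : ℝ) (hα0 : 0 < α) (hα1 : α < 1) (hab : a < b)
    (u : ℝ → ℝ) (hu : ContinuousOn u (Set.Icc a b))
    (k q : ℕ) (hq : 1 ≤ q) (tk : ℕ → ℝ)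
    (h0 : tk 0 = a) (hend : tk (k + 1) = b) (hmono : ∀ i ≤ k, tk i < tk (i + 1))
    (h : ℝ)
    (hdef : h = (Finset.range (k + 1)).sup'
      (Finset.nonempty_range_iff.mpr (Nat.succ_ne_zero k)) (fun i => tk (i + 1) - tk i)) :
    sSup ((fun t => |spline tk k q (rlInt a α u) t|) '' Set.Icc a b) ≤
      (5 / 2 * (h / Real.sqrt q) ^ α + (b - a) ^ α) / Real.Gamma (α + 1) * supNorm u a b := by
  have hbdd : BddAbove ((fun t => |u t|) '' Set.Icc a b) :=
    (isCompact_Icc.image_of_continuousOn hu.abs).bddAbove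
  have hM : ∀ s ∈ Set.Icc a b, |u s| ≤ supNorm u a b := fun s hs =>
    le_csSup hbdd ⟨s, hs, rfl⟩
  have hM0 : 0 ≤ supNorm u a b := (abs_nonneg _).trans (hM a ⟨le_rfl, hab.le⟩)
  have hG : 0 < Real.Gamma (α + 1) := Real.Gamma_pos_of_pos (by linarith)
  have hh : 0 ≤ h := by
    rw [hdef]
    refine le_trans ?_ (Finset.le_sup' (fun i => tk (i + 1) - tk i)
      (Finset.mem_range.mpr (Nat.succ_pos k)))
    have := hmono 0 (Nat.zero_le _)
    linarith
  have hp : 0 ≤ (h / Real.sqrt q) ^ α := Real.rpow_nonneg (by positivity) _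
  have hpb : 0 ≤ (b - a) ^ α := Real.rpow_nonneg (by linarith) _
  have hK : (b - a) ^ α / Real.Gamma (α + 1) * supNorm u a b ≤
      (5 / 2 * (h / Real.sqrt q) ^ α + (b - a) ^ α) / Real.Gamma (α + 1) * supNorm u a b := by
    gcongr
    linarith
  refine csSup_le ((Set.nonempty_Icc.mpr hab.le).image _) ?_
  rintro _ ⟨t, -, rfl⟩
  refine le_trans ?_ hK
  simp only [spline]
  by_cases hex : ∃ i ∈ Finset.range (k + 1), t ∈ knotSet tk k i
  · obtain ⟨i, hi, hti⟩ := hex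
    have hik : i ≤ k := Nat.lt_succ_iff.mp (Finset.mem_range.mp hi)
    rw [Finset.sum_eq_single_of_mem i hi, Set.indicator_of_mem hti]
    · refine bern_bound _ _ _ (hmono i hik) q hq _ (fun s hs => ?_) t (knotSet_sub tk k i hti)
      refine rl_bound α a b _ hα0 u hM s ⟨?_, ?_⟩
      · rw [← h0]
        exact (knot_mono tk k hmono 0 i (Nat.zero_le _) (by omega)).trans hs.1
      · rw [← hend]
        exact hs.2.trans (knot_mono tk k hmono (i + 1) (k + 1) (by omega) le_rfl)
    · intro j hj hne
      have hjk : j ≤ k := Nat.lt_succ_iff.mp (Finset.mem_range.mp hj)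
      apply Set.indicator_of_notMem
      rcases lt_or_gt_of_ne hne with hlt | hlt
      · exact fun hc => knot_disj tk k hmono j i hlt hik t hc hti
      · exact knot_disj tk k hmono i j hlt hjk t hti
  · push Not at hex
    rw [Finset.sum_eq_zero fun i hi => Set.indicator_of_notMem (hex i hi) _, abs_zero]
    positivity
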